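/- Let U ⊆ ℝⁿ be open and let ∇ be a torsion-free affine connection on U with curvature R_{ab}^c_d, and assume ∇_a R_{bc}^d_e = 0 on U. Then at every point of U and for all indices a, b, c, d, p, q one has R_{cd}^p_e R_{ab}^e_q − R_{cd}^e_q R_{ab}^p_e + R_{ce}^p_q R_{ab}^e_d − R_{de}^p_q R_{ab}^e_c = 0 (summation over e); that is, the curvature lies in Γ(K ⊗ K̂), where K̂ is the space of endomorphisms φ_c^d satisfying R_{ab}^d_e φ_c^e − R_{ab}^e_c φ_e^d + R_{ae}^d_c φ_b^e − R_{be}^d_c φ_a^e = 0. -/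

import Mathlib

open scoped BigOperators

noncomputable section

/-- Partial derivative in coordinate direction `a`. -/
def pd {n : ℕ} (a : Fin n) (f : (Fin n → ℝ) → ℝ) (x : Fin n → ℝ) : ℝ :=
  fderiv ℝ f x (Pi.single a 1)

/-- Curvature `R_{ab}ᶜ_d` of the affine connection with Christoffel symbols `Γ`. -/
def curv {n : ℕ} (Γ : Fin n → Fin n → Fin n → (Fin n → ℝ) → ℝ)
    (a b c d : Fin n) (x : Fin n → ℝ) : ℝ :=
  pd a (Γ b d c) x - pd b (Γ a d c) x +
    ∑ e, (Γ b d e x * Γ a e c x - Γ a d e x * Γ b e c x)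

/-- Covariant derivative `∇_a R_{bc}ᵈ_e` of the curvature. -/
def covR {n : ℕ} (Γ : Fin n → Fin n → Fin n → (Fin n → ℝ) → ℝ)
    (a b c d e : Fin n) (x : Fin n → ℝ) : ℝ :=
  pd a (curv Γ b c d e) x - ∑ f, Γ a b f x * curv Γ f c d e x
    - ∑ f, Γ a c f x * curv Γ b f d e x + ∑ f, Γ a f d x * curv Γ b c f e x
    - ∑ f, Γ a e f x * curv Γ b c d f x

/-- Membership of an antisymmetric bilinear form `m` in the space `K_x`. -/
def Kmem {n : ℕ} (Γ : Fin n → Fin n → Fin n → (Fin n → ℝ) → ℝ)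
    (x : Fin n → ℝ) (m : Fin n → Fin n → ℝ) : Prop :=
  (∀ b c, m b c = - m c b) ∧
  ∀ a b c d, ∑ e, (curv Γ a b e c x * m d e - curv Γ a b e d x * m c e
    + curv Γ c d e a x * m b e - curv Γ c d e b x * m a e) = 0

/-- Membership of an endomorphism `φ_cᵈ` in the space `K̂_x`. -/
def KhatMem {n : ℕ} (Γ : Fin n → Fin n → Fin n → (Fin n → ℝ) → ℝ)
    (x : Fin n → ℝ) (φ : Fin n → Fin n → ℝ) : Prop :=
  ∀ a b c d, ∑ e, (curv Γ a b d e x * φ c e - curv Γ a b e c x * φ e d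
    + curv Γ a e d c x * φ b e - curv Γ b e d c x * φ a e) = 0

open scoped ContDiff

section PartialDerivative

variable {n : ℕ} {x : Fin n → ℝ}

theorem pd_congr_of_eventuallyEq {f g : (Fin n → ℝ) → ℝ} (h : f =ᶠ[nhds x] g) (a : Fin n) :
    pd a f x = pd a g x := by
  simp only [pd, h.fderiv_eq]

theorem pd_comm {f : (Fin n → ℝ) → ℝ} (hf : ContDiffAt ℝ ∞ f x) (a b : Fin n) :
    pd a (pd b f) x = pd b (pd a f) x := by
  have hd : DifferentiableAt ℝ (fderiv ℝ f) x :=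
    (hf.fderiv_right (m := 1) (by norm_cast)).differentiableAt (by simp)
  have key : ∀ c d : Fin n, pd c (pd d f) x =
      fderiv ℝ (fderiv ℝ f) x (Pi.single c 1) (Pi.single d 1) := by
    intro c d
    have : HasFDerivAt (pd d f) _ x := hd.hasFDerivAt.clm_apply (hasFDerivAt_const _ x)
    simp [pd, this.fderiv]
  rw [key, key]
  exact hf.isSymmSndFDerivAt (by simp; norm_cast) _ _

theorem ContDiffOn.pd {U : Set (Fin n → ℝ)} (hU : IsOpen U) {f : (Fin n → ℝ) → ℝ}
    (hf : ContDiffOn ℝ ∞ f U) (a : Fin n) : ContDiffOn ℝ ∞ (pd a f) U :=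
  (hf.fderiv_of_isOpen hU (by norm_cast)).clm_apply contDiffOn_const

end PartialDerivative

section Curvature

variable {n : ℕ} (Γ : Fin n → Fin n → Fin n → (Fin n → ℝ) → ℝ)

theorem curv_antisymm (a b c d : Fin n) (x : Fin n → ℝ) :
    curv Γ a b c d x = -curv Γ b a c d x := by
  simp only [curv, Finset.sum_sub_distrib]
  ring

theorem contDiffOn_curv {U : Set (Fin n → ℝ)} (hU : IsOpen U)
    (hΓ : ∀ a b c, ContDiffOn ℝ ∞ (Γ a b c) U) (a b c d : Fin n) :
    ContDiffOn ℝ ∞ (curv Γ a b c d) U := by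
  have hs : ContDiffOn ℝ ∞ (fun x => ∑ e, (Γ b d e x * Γ a e c x - Γ a d e x * Γ b e c x)) U :=
    ContDiffOn.sum fun e _ => ((hΓ _ _ _).mul (hΓ _ _ _)).sub ((hΓ _ _ _).mul (hΓ _ _ _))
  exact (((hΓ _ _ _).pd hU _).sub ((hΓ _ _ _).pd hU _)).add hs

end Curvature

/-- The derivation action of the matrix `A` on tensors `R_{cd}ᵖ_q`, with the sign for which
`∂_a R` equals the action of the connection matrix `Γ_a` on `R` when `R` is parallel. -/
def tensorAction {n : ℕ} (A : Fin n → Fin n → ℝ) (R : Fin n → Fin n → Fin n → Fin n → ℝ)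
    (c d p q : Fin n) : ℝ :=
  ∑ f, (A c f * R f d p q + A d f * R c f p q - A f p * R c d f q + A q f * R c d p f)

theorem tensorAction_commutator {n : ℕ} (A B : Fin n → Fin n → ℝ)
    (R : Fin n → Fin n → Fin n → Fin n → ℝ) (c d p q : Fin n) :
    tensorAction A (tensorAction B R) c d p q - tensorAction B (tensorAction A R) c d p q =
      tensorAction (fun u v => ∑ e, (A u e * B e v - B u e * A e v)) R c d p q := by
  have hcross := Finset.sum_comm (s := Finset.univ) (t := Finset.univ) (f := fun f g : Fin n =>
    B c f * (A d g * R f g p q - A g p * R f d g q + A q g * R f d p g) +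
    B d f * (A c g * R g f p q - A g p * R c f g q + A q g * R c f p g) -
    B f p * (A c g * R g d f q + A d g * R c g f q + A q g * R c d f g) +
    B q f * (A c g * R g d p f + A d g * R c g p f - A g p * R c d g f))
  have hdiag := Finset.sum_comm (s := Finset.univ) (t := Finset.univ) (f := fun f g : Fin n =>
    (A c g * B g f - B c g * A g f) * R f d p q + (A d g * B g f - B d g * A g f) * R c f p q
    - (A f g * B g p - B f g * A g p) * R c d f q + (A q g * B g f - B q g * A g f) * R c d p f)
  simp only [tensorAction, Finset.mul_sum, Finset.sum_mul, ← Finset.sum_sub_distrib,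
    ← Finset.sum_add_distrib] at *
  rw [hdiag, ← sub_eq_zero]
  rw [eq_comm, ← sub_eq_zero] at hcross
  rw [← hcross]
  simp only [← Finset.sum_sub_distrib]
  exact Finset.sum_congr rfl fun f _ => Finset.sum_congr rfl fun g _ => by ring

section LocallySymmetric

variable {n : ℕ} {U : Set (Fin n → ℝ)} {Γ : Fin n → Fin n → Fin n → (Fin n → ℝ) → ℝ}

theorem pd_curv_eq_tensorAction {x : Fin n → ℝ} {a c d p q : Fin n}
    (h : covR Γ a c d p q x = 0) :
    pd a (curv Γ c d p q) x =
      tensorAction (fun u v => Γ a u v x) (fun i j k l => curv Γ i j k l x) c d p q := by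
  simp only [covR, tensorAction, Finset.sum_add_distrib, Finset.sum_sub_distrib] at *
  linarith

theorem pd_tensorAction {x : Fin n → ℝ} {A : Fin n → Fin n → (Fin n → ℝ) → ℝ}
    {R : Fin n → Fin n → Fin n → Fin n → (Fin n → ℝ) → ℝ}
    (hA : ∀ u v, DifferentiableAt ℝ (A u v) x)
    (hR : ∀ i j k l, DifferentiableAt ℝ (R i j k l) x) (a c d p q : Fin n) :
    pd a (fun y => tensorAction (fun u v => A u v y) (fun i j k l => R i j k l y) c d p q) x =
      tensorAction (fun u v => pd a (A u v) x) (fun i j k l => R i j k l x) c d p q +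
      tensorAction (fun u v => A u v x) (fun i j k l => pd a (R i j k l) x) c d p q := by
  have hsum : HasFDerivAt (fun y => tensorAction (fun u v => A u v y)
      (fun i j k l => R i j k l y) c d p q) _ x :=
    HasFDerivAt.fun_sum (u := Finset.univ) fun f _ =>
      ((((hA c f).hasFDerivAt.mul (hR f d p q).hasFDerivAt).add
        ((hA d f).hasFDerivAt.mul (hR c f p q).hasFDerivAt)).sub
        ((hA f p).hasFDerivAt.mul (hR c d f q).hasFDerivAt)).add
        ((hA q f).hasFDerivAt.mul (hR c d p f).hasFDerivAt)
  rw [pd, hsum.fderiv]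
  simp only [tensorAction, pd, ← Finset.sum_add_distrib,
    sum_apply, add_apply, sub_apply, smul_apply, smul_eq_mul]
  exact Finset.sum_congr rfl fun f _ => by ring

/-- The Ricci identity applied to a parallel curvature tensor. -/
theorem tensorAction_curv_eq_zero (hU : IsOpen U)
    (hΓ : ∀ a b c, ContDiffOn ℝ ∞ (Γ a b c) U)
    (hR : ∀ a b c d e, ∀ x ∈ U, covR Γ a b c d e x = 0)
    {x : Fin n → ℝ} (hx : x ∈ U) (a b c d p q : Fin n) :
    tensorAction (fun u v => curv Γ a b v u x) (fun i j k l => curv Γ i j k l x) c d p q = 0 := by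
  have hUx : U ∈ nhds x := hU.mem_nhds hx
  have hΓd : ∀ a b c, DifferentiableAt ℝ (Γ a b c) x := fun a b c =>
    ((hΓ a b c).contDiffAt hUx).differentiableAt (by simp)
  have hRc : ∀ a b c d, ContDiffAt ℝ ∞ (curv Γ a b c d) x := fun a b c d =>
    (contDiffOn_curv Γ hU hΓ a b c d).contDiffAt hUx
  have hRd : ∀ a b c d, DifferentiableAt ℝ (curv Γ a b c d) x := fun a b c d =>
    (hRc a b c d).differentiableAt (by simp)
  have second : ∀ a b, pd a (pd b (curv Γ c d p q)) x =
      tensorAction (fun u v => pd a (Γ b u v) x) (fun i j k l => curv Γ i j k l x) c d p q +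
      tensorAction (fun u v => Γ b u v x)
        (tensorAction (fun u v => Γ a u v x) (fun i j k l => curv Γ i j k l x)) c d p q := by
    intro a b
    have heq : pd b (curv Γ c d p q) =ᶠ[nhds x] fun y =>
        tensorAction (fun u v => Γ b u v y) (fun i j k l => curv Γ i j k l y) c d p q := by
      filter_upwards [hUx] with y hy using pd_curv_eq_tensorAction (hR b c d p q y hy)
    rw [pd_congr_of_eventuallyEq heq, pd_tensorAction (hΓd b) hRd]
    simp only [pd_curv_eq_tensorAction (hR _ _ _ _ _ x hx)]
  have hcomm := pd_comm (hRc c d p q) a b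
  rw [second, second] at hcomm
  have hbracket := tensorAction_commutator (fun u v => Γ b u v x) (fun u v => Γ a u v x)
    (fun i j k l => curv Γ i j k l x) c d p q
  have hsplit : tensorAction (fun u v => curv Γ a b v u x)
      (fun i j k l => curv Γ i j k l x) c d p q =
      tensorAction (fun u v => pd a (Γ b u v) x) (fun i j k l => curv Γ i j k l x) c d p q -
      tensorAction (fun u v => pd b (Γ a u v) x) (fun i j k l => curv Γ i j k l x) c d p q +
      tensorAction (fun u v => ∑ e, (Γ b u e x * Γ a e v x - Γ a u e x * Γ b e v x))
        (fun i j k l => curv Γ i j k l x) c d p q := by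
    have hF : ∀ u v, curv Γ a b v u x = pd a (Γ b u v) x - pd b (Γ a u v) x +
        ∑ e, (Γ b u e x * Γ a e v x - Γ a u e x * Γ b e v x) := fun _ _ => rfl
    generalize (fun i j k l => curv Γ i j k l x) = R
    simp only [tensorAction, hF, ← Finset.sum_sub_distrib, ← Finset.sum_add_distrib]
    exact Finset.sum_congr rfl fun f _ => by ring
  linarith

end LocallySymmetric


/-- **Curvature of a locally symmetric connection lies in `Γ(K ⊗ K̂)`.**
If `∇_a R_{bc}ᵈ_e = 0` then
`R_{cd}ᵖ_e R_{ab}ᵉ_q − R_{cd}ᵉ_q R_{ab}ᵖ_e + R_{ce}ᵖ_q R_{ab}ᵉ_d − R_{de}ᵖ_q R_{ab}ᵉ_c = 0`;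
that is, for each fixed `a, b`, the endomorphism `(u,v) ↦ R_{ab}ᵛ_u` lies in `K̂`. -/
theorem curvature_in_K_tensor_Khat
    {n : ℕ} (hn : 1 ≤ n) (U : Set (Fin n → ℝ)) (hU : IsOpen U)
    (Γ : Fin n → Fin n → Fin n → (Fin n → ℝ) → ℝ)
    (hΓsmooth : ∀ a b c, ContDiffOn ℝ (⊤ : ℕ∞) (Γ a b c) U)
    (hΓsym : ∀ a b c, ∀ x ∈ U, Γ a b c x = Γ b a c x)
    (hlocsym : ∀ a b c d e, ∀ x ∈ U, covR Γ a b c d e x = 0) :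
    ∀ x ∈ U, ∀ a b c d p q : Fin n,
      (∑ e, (curv Γ c d p e x * curv Γ a b e q x -
             curv Γ c d e q x * curv Γ a b p e x +
             curv Γ c e p q x * curv Γ a b e d x -
             curv Γ d e p q x * curv Γ a b e c x) = 0) ∧
      KhatMem Γ x (fun u v => curv Γ a b v u x) := by
  have key : ∀ x ∈ U, ∀ a b c d p q : Fin n,
      ∑ e, (curv Γ c d p e x * curv Γ a b e q x - curv Γ c d e q x * curv Γ a b p e x +
        curv Γ c e p q x * curv Γ a b e d x - curv Γ d e p q x * curv Γ a b e c x) = 0 := by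
    intro x hx a b c d p q
    rw [← tensorAction_curv_eq_zero hU hΓsmooth hlocsym hx a b c d p q]
    refine Finset.sum_congr rfl fun e _ => ?_
    rw [curv_antisymm Γ d e p q x]
    ring
  exact fun x hx a b c d p q =>
    ⟨key x hx a b c d p q, fun a' b' c' d' => key x hx a b a' b' d' c'⟩

end
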